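/- Let δ, ε > 0 be real and s ≥ 0 an integer, and consider a time-varying FJ model (Λ(k), W(k)), k = 0, 1, …. If the sequence (Λ(k), W(k))_{k=0}^∞ contains infinitely many (pairwise disjoint) subsequences of consecutive terms (Λ(k), W(k))_{k=m}^{m+s} belonging to the class CFJ[δ, ε, s], then the model is asymptotically stable, i.e. the product Λ(k)W(k)·Λ(k−1)W(k−1)⋯Λ(0)W(0) tends to the zero matrix as k → ∞. -/

import Mathlib

open Filter

/-- The backward matrix product `Λ(k)W(k)·Λ(k−1)W(k−1)⋯Λ(0)W(0)`. -/
noncomputable def prodA {n : ℕ} (lam : ℕ → Fin n → ℝ)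
    (W : ℕ → Matrix (Fin n) (Fin n) ℝ) : ℕ → Matrix (Fin n) (Fin n) ℝ
  | 0 => Matrix.diagonal (lam 0) * W 0
  | k + 1 => (Matrix.diagonal (lam (k + 1)) * W (k + 1)) * prodA lam W k

/-- The index sets `J_k`: `J₀ = S_{Λ^(0)}^δ` and
`J_k = S_{Λ^(k)}^δ ∪ {i : w^(k)_{ij} ≥ ε for some j ∈ J_{k−1}}`. -/
def Jset {n : ℕ} (lam : ℕ → Fin n → ℝ) (W : ℕ → Matrix (Fin n) (Fin n) ℝ)
    (δ ε : ℝ) : ℕ → Set (Fin n)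
  | 0 => {i | lam 0 i ≤ 1 - δ}
  | k + 1 => {i | lam (k + 1) i ≤ 1 - δ} ∪
      {i | ∃ j ∈ Jset lam W δ ε k, ε ≤ W (k + 1) i j}

/-- The sequence `(Λ^(k), W^(k))_{k=0}^s` belongs to the class `CFJ[δ, ε, s]`
if `J_s = {1,…,n}`. -/
def memCFJ {n : ℕ} (lam : ℕ → Fin n → ℝ) (W : ℕ → Matrix (Fin n) (Fin n) ℝ)
    (δ ε : ℝ) (s : ℕ) : Prop :=
  Jset lam W δ ε s = Set.univ

lemma sum_mul_le_of_le {n : ℕ} {w x : Fin n → ℝ} {c : ℝ} (hw0 : ∀ j, 0 ≤ w j)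
    (hw1 : ∑ j, w j = 1) (hx : ∀ j, x j ≤ c) : ∑ j, w j * x j ≤ c :=
  calc ∑ j, w j * x j ≤ ∑ j, w j * c :=
        Finset.sum_le_sum fun j _ => mul_le_mul_of_nonneg_left (hx j) (hw0 j)
    _ = c := by rw [← Finset.sum_mul, hw1, one_mul]

lemma sum_mul_le_of_le_of_weight {n : ℕ} {w x : Fin n → ℝ} {c ε η : ℝ} (hc : 0 ≤ c)
    (hη : 0 ≤ η) (hw0 : ∀ j, 0 ≤ w j) (hw1 : ∑ j, w j = 1) (hx : ∀ j, x j ≤ c) {j : Fin n}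
    (hj : x j ≤ (1 - η) * c) (hε : ε ≤ w j) : ∑ j, w j * x j ≤ (1 - η * ε) * c := by
  have h1 : w j * (c - x j) ≤ ∑ j, w j * (c - x j) :=
    Finset.single_le_sum (f := fun j => w j * (c - x j))
      (fun j _ => mul_nonneg (hw0 j) (sub_nonneg.2 (hx j))) (Finset.mem_univ j)
  have h2 : ∑ j, w j * (c - x j) = c - ∑ j, w j * x j := by
    simp only [mul_sub, Finset.sum_sub_distrib]
    rw [← Finset.sum_mul, hw1, one_mul]
  have h3 : w j * (η * c) ≤ w j * (c - x j) :=
    mul_le_mul_of_nonneg_left (by linarith) (hw0 j)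
  have h4 : ε * (η * c) ≤ w j * (η * c) :=
    mul_le_mul_of_nonneg_right hε (mul_nonneg hη hc)
  linarith

/-- If `v` evolves by `v (k + 1) = Λ(k + 1) W(k + 1) v k`, then an upper bound on its entries
persists. -/
lemma le_of_le_of_evolution {n : ℕ} {lam : ℕ → Fin n → ℝ} {W : ℕ → Matrix (Fin n) (Fin n) ℝ}
    (hW0 : ∀ k i j, 0 ≤ W k i j) (hW1 : ∀ k i, ∑ j, W k i j = 1)
    (hlam : ∀ k i, 0 ≤ lam k i ∧ lam k i ≤ 1) {v : ℕ → Fin n → ℝ}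
    (hv : ∀ k i, v (k + 1) i = lam (k + 1) i * ∑ j, W (k + 1) i j * v k j)
    {c : ℝ} (hc : 0 ≤ c) {k : ℕ} (h : ∀ i, v k i ≤ c) {l : ℕ} (hkl : k ≤ l) (i : Fin n) :
    v l i ≤ c := by
  induction l, hkl using Nat.le_induction generalizing i with
  | base => exact h i
  | succ l _ ih =>
    rw [hv]
    exact (mul_le_mul_of_nonneg_left (sum_mul_le_of_le (hW0 _ i) (hW1 _ i) ih)
      (hlam _ i).1).trans (mul_le_of_le_one_left hc (hlam _ i).2)

/-- Along a window of consecutive steps, the entries indexed by `J_t` contract by `1 - δ ε ^ t`. -/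
lemma le_of_mem_Jset {n : ℕ} {lam : ℕ → Fin n → ℝ} {W : ℕ → Matrix (Fin n) (Fin n) ℝ}
    (hW0 : ∀ k i j, 0 ≤ W k i j) (hW1 : ∀ k i, ∑ j, W k i j = 1)
    (hlam : ∀ k i, 0 ≤ lam k i ∧ lam k i ≤ 1) {v : ℕ → Fin n → ℝ}
    (hv : ∀ k i, v (k + 1) i = lam (k + 1) i * ∑ j, W (k + 1) i j * v k j)
    {δ ε : ℝ} (hδ : 0 < δ) (hδ1 : δ ≤ 1) (hε : 0 < ε) (hε1 : ε ≤ 1) {c : ℝ} (hc : 0 ≤ c) {p : ℕ}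
    (h : ∀ i, v p i ≤ c) (t : ℕ) (i : Fin n)
    (hi : i ∈ Jset (fun k => lam (p + 1 + k)) (fun k => W (p + 1 + k)) δ ε t) :
    v (p + 1 + t) i ≤ (1 - δ * ε ^ t) * c := by
  have stubborn : ∀ q, p ≤ q → ∀ i, lam (q + 1) i ≤ 1 - δ → v (q + 1) i ≤ (1 - δ) * c := by
    intro q hq i hi
    rw [hv]
    exact (mul_le_mul_of_nonneg_left (sum_mul_le_of_le (hW0 _ i) (hW1 _ i)
      (le_of_le_of_evolution hW0 hW1 hlam hv hc h hq)) (hlam _ i).1).trans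
      (mul_le_mul_of_nonneg_right hi hc)
  induction t generalizing i with
  | zero => simpa using stubborn p le_rfl i hi
  | succ t ih =>
    rcases hi with hi | ⟨j, hj, hw⟩
    · refine (stubborn (p + 1 + t) (by omega) i hi).trans (mul_le_mul_of_nonneg_right ?_ hc)
      have := mul_le_of_le_one_right hδ.le (pow_le_one₀ (n := t + 1) hε.le hε1)
      linarith
    · have hb := sum_mul_le_of_le_of_weight hc (by positivity) (hW0 _ i) (hW1 _ i)
        (le_of_le_of_evolution hW0 hW1 hlam hv hc h (by omega : p ≤ p + 1 + t)) (ih j hj) hw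
      have hfac : 0 ≤ 1 - δ * ε ^ (t + 1) :=
        sub_nonneg.2 (mul_le_one₀ hδ1 (by positivity) (pow_le_one₀ hε.le hε1))
      rw [mul_assoc δ, ← pow_succ] at hb
      rw [← add_assoc, hv]
      exact (mul_le_mul_of_nonneg_left hb (hlam _ i).1).trans
        (mul_le_of_le_one_left (mul_nonneg hfac hc) (hlam _ i).2)

lemma Jset_mono {n : ℕ} {lam : ℕ → Fin n → ℝ} {W : ℕ → Matrix (Fin n) (Fin n) ℝ}
    {δ δ' ε ε' : ℝ} (hδ : δ' ≤ δ) (hε : ε' ≤ ε) (t : ℕ) :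
    Jset lam W δ ε t ⊆ Jset lam W δ' ε' t := by
  induction t with
  | zero => exact fun i (hi : lam 0 i ≤ 1 - δ) => show lam 0 i ≤ 1 - δ' by linarith
  | succ t ih =>
    rintro i (hi | ⟨j, hj, hw⟩)
    · exact Or.inl (le_trans hi (sub_le_sub_left hδ 1))
    · exact Or.inr ⟨j, ih hj, hε.trans hw⟩

lemma prodA_nonneg {n : ℕ} {lam : ℕ → Fin n → ℝ} {W : ℕ → Matrix (Fin n) (Fin n) ℝ}
    (hW0 : ∀ k i j, 0 ≤ W k i j) (hlam : ∀ k i, 0 ≤ lam k i) (k : ℕ) (i j : Fin n) :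
    0 ≤ prodA lam W k i j := by
  induction k generalizing i j with
  | zero =>
    rw [prodA, Matrix.diagonal_mul]
    exact mul_nonneg (hlam _ _) (hW0 _ _ _)
  | succ k ih =>
    rw [prodA, Matrix.mul_assoc, Matrix.diagonal_mul, Matrix.mul_apply]
    exact mul_nonneg (hlam _ _) (Finset.sum_nonneg fun l _ => mul_nonneg (hW0 _ _ _) (ih _ _))

lemma prodA_succ_row_sum {n : ℕ} (lam : ℕ → Fin n → ℝ) (W : ℕ → Matrix (Fin n) (Fin n) ℝ)
    (k : ℕ) (i : Fin n) : ∑ j, prodA lam W (k + 1) i j =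
      lam (k + 1) i * ∑ j, W (k + 1) i j * ∑ l, prodA lam W k j l := by
  simp_rw [prodA, Matrix.mul_assoc, Matrix.diagonal_mul, Matrix.mul_apply, Finset.mul_sum]
  exact Finset.sum_comm

/-- Theorem 5: if the sequence `(Λ(k), W(k))_{k=0}^∞` contains infinitely many
subsequences of consecutive terms `(Λ(k), W(k))_{k=m}^{m+s}` belonging to
`CFJ[δ, ε, s]`, then the time-varying FJ model is asymptotically stable:
`Λ(k)W(k)⋯Λ(0)W(0) → 0`. -/
theorem stability_of_infinitely_many_CFJ {n : ℕ}
    (lam : ℕ → Fin n → ℝ) (W : ℕ → Matrix (Fin n) (Fin n) ℝ)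
    (hW0 : ∀ k i j, 0 ≤ W k i j) (hW1 : ∀ k i, ∑ j, W k i j = 1)
    (hlam : ∀ k i, 0 ≤ lam k i ∧ lam k i ≤ 1)
    (δ ε : ℝ) (hδ : 0 < δ) (hε : 0 < ε) (s : ℕ)
    (hinf : ∀ N : ℕ, ∃ m ≥ N,
      memCFJ (fun k => lam (m + k)) (fun k => W (m + k)) δ ε s) :
    Tendsto (prodA lam W) atTop (nhds 0) := by
  set δ' := min δ 1
  set ε' := min ε 1
  have hδ' : 0 < δ' := lt_min hδ one_pos
  have hε' : 0 < ε' := lt_min hε one_pos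
  have hδ1 : δ' ≤ 1 := min_le_right _ _
  have hε1 : ε' ≤ 1 := min_le_right _ _
  set r := 1 - δ' * ε' ^ s
  have hr0 : 0 ≤ r :=
    sub_nonneg.2 (mul_le_one₀ hδ1 (by positivity) (pow_le_one₀ hε'.le hε1))
  have hr1 : r < 1 := sub_lt_self 1 (by positivity)
  set v : ℕ → Fin n → ℝ := fun k i => ∑ j, prodA lam W k i j
  have hv : ∀ k i, v (k + 1) i = lam (k + 1) i * ∑ j, W (k + 1) i j * v k j :=
    prodA_succ_row_sum lam W
  have hA := prodA_nonneg hW0 fun k i => (hlam k i).1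
  have hbound : ∀ q : ℕ, ∃ K, ∀ k ≥ K, ∀ i, v k i ≤ r ^ q := by
    intro q
    suffices ∃ K, ∀ i, v K i ≤ r ^ q from
      this.imp fun K hK k hk => le_of_le_of_evolution hW0 hW1 hlam hv (pow_nonneg hr0 q) hK hk
    induction q with
    | zero =>
      refine ⟨0, fun i => ?_⟩
      simp only [v, prodA, Matrix.diagonal_mul, ← Finset.mul_sum, hW1, mul_one, pow_zero]
      exact (hlam 0 i).2
    | succ q ih =>
      obtain ⟨K, hK⟩ := ih
      obtain ⟨m, hm, hJ⟩ := hinf (K + 1)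
      obtain ⟨p, rfl⟩ : ∃ p, m = p + 1 := ⟨m - 1, by omega⟩
      refine ⟨p + 1 + s, fun i => ?_⟩
      rw [pow_succ']
      exact le_of_mem_Jset hW0 hW1 hlam hv hδ' hδ1 hε' hε1 (pow_nonneg hr0 q)
        (le_of_le_of_evolution hW0 hW1 hlam hv (pow_nonneg hr0 q) hK
          (Nat.le_of_succ_le_succ hm)) s i
        (Jset_mono (min_le_left _ _) (min_le_left _ _) s (hJ ▸ Set.mem_univ i))
  refine tendsto_pi_nhds.2 fun i => tendsto_pi_nhds.2 fun j => Metric.tendsto_atTop.2 ?_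
  intro e he
  obtain ⟨q, hq⟩ := exists_pow_lt_of_lt_one he hr1
  refine (hbound q).imp fun K hK k hk => ?_
  rw [Matrix.zero_apply, Real.dist_0_eq_abs, abs_of_nonneg (hA k i j)]
  exact ((Finset.single_le_sum (fun l _ => hA k i l) (Finset.mem_univ j)).trans
    (hK k hk i)).trans_lt hq
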